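/- arXiv:2403.16323 — 4 statements merged into one kernel-verified Lean document; each statement's English description precedes it below -/
import Mathlib

section
/- For all real numbers c_1, …, c_m and every vector v ∈ E, one has ‖(Σ_{i=1}^m c_i γ_i) v‖² = (Σ_{i=1}^m c_i²)·‖v‖²; consequently the operator norm of Σ_{i=1}^m c_i γ_i equals √(Σ_{i=1}^m c_i²). -/
open scoped BigOperators

/-- The square of a linear combination of pairwise anticommuting involutions is the scalar given
by the sum of the squares of the coefficients. -/
theorem sum_smul_mul_self_of_anticommute {R A ι : Type*} [CommRing R] [Ring A] [Algebra R A]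
    (γ : ι → A) (hsq : ∀ i, γ i * γ i = 1) (hanti : ∀ i j, i ≠ j → γ i * γ j = -(γ j * γ i))
    (c : ι → R) (s : Finset ι) :
    (∑ i ∈ s, c i • γ i) * (∑ i ∈ s, c i • γ i) = (∑ i ∈ s, c i ^ 2) • (1 : A) := by
  classical
  induction s using Finset.induction_on with
  | empty => simp
  | insert a s ha ih =>
    have hcross : (c a • γ a) * (∑ i ∈ s, c i • γ i) = -((∑ i ∈ s, c i • γ i) * (c a • γ a)) := by
      rw [Finset.mul_sum, Finset.sum_mul, ← Finset.sum_neg_distrib]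
      refine Finset.sum_congr rfl fun i hi => ?_
      have hai : a ≠ i := fun h => ha (h ▸ hi)
      rw [smul_mul_smul_comm, smul_mul_smul_comm, hanti a i hai, smul_neg, mul_comm (c a)]
    rw [Finset.sum_insert ha, Finset.sum_insert ha, add_mul, mul_add, mul_add, ih, hcross,
      smul_mul_smul_comm, hsq, add_smul, pow_two]
    abel

/-- Let `E` be a nonzero finite-dimensional complex inner product space and
`γ_1, …, γ_m` self-adjoint unitary pairwise anticommuting operators on `E`. For all real
numbers `c_1, …, c_m` and every `v ∈ E`, `‖(Σ_i c_i γ_i) v‖² = (Σ_i c_i²)·‖v‖²`;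
consequently `‖Σ_i c_i γ_i‖ = √(Σ_i c_i²)`. -/
theorem clifford_sum_norm {E : Type*} [NormedAddCommGroup E] [InnerProductSpace ℂ E]
    [FiniteDimensional ℂ E] [Nontrivial E]
    {m : ℕ} (γ : Fin m → (E →L[ℂ] E))
    (hsa : ∀ i, IsSelfAdjoint (γ i))
    (hunit : ∀ i, γ i * γ i = 1)
    (hanti : ∀ i j, i ≠ j → γ i * γ j = -(γ j * γ i))
    (c : Fin m → ℝ) :
    (∀ v : E, ‖(∑ i, ((c i : ℂ) • γ i)) v‖ ^ 2 = (∑ i, (c i) ^ 2) * ‖v‖ ^ 2) ∧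
    ‖∑ i, ((c i : ℂ) • γ i)‖ = Real.sqrt (∑ i, (c i) ^ 2) := by
  set S : E →L[ℂ] E := ∑ i, ((c i : ℂ) • γ i)
  have hSsa : ∀ x y : E, inner ℂ (S x) y = inner ℂ x (S y) := by
    have hself : IsSelfAdjoint S := by
      refine isSelfAdjoint_sum _ fun i _ => IsSelfAdjoint.smul ?_ (hsa i)
      exact Complex.conj_ofReal (c i)
    exact hself.isSymmetric
  have hsq : S * S = (∑ i, (c i : ℂ) ^ 2) • (1 : E →L[ℂ] E) :=
    sum_smul_mul_self_of_anticommute γ hunit hanti (fun i => (c i : ℂ)) Finset.univ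
  have hnorm : ∀ v : E, ‖S v‖ ^ 2 = (∑ i, (c i) ^ 2) * ‖v‖ ^ 2 := by
    intro v
    have hSS : S (S v) = (∑ i, (c i : ℂ) ^ 2) • v := by
      simpa using congrArg (fun T : E →L[ℂ] E => T v) hsq
    have h : ((‖S v‖ : ℂ)) ^ 2 = (∑ i, (c i : ℂ) ^ 2) * (‖v‖ : ℂ) ^ 2 := by
      have h1 := inner_self_eq_norm_sq_to_K (𝕜 := ℂ) (S v)
      have h2 := inner_self_eq_norm_sq_to_K (𝕜 := ℂ) v
      rw [hSsa, hSS, inner_smul_right, h2] at h1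
      exact h1.symm
    exact_mod_cast h
  have hnonneg : 0 ≤ ∑ i, (c i) ^ 2 := Finset.sum_nonneg fun i _ => sq_nonneg _
  refine ⟨hnorm, ?_⟩
  have happ : ∀ v : E, ‖S v‖ = Real.sqrt (∑ i, (c i) ^ 2) * ‖v‖ := by
    intro v
    rw [← Real.sqrt_sq (norm_nonneg (S v)), hnorm, Real.sqrt_mul hnonneg,
      Real.sqrt_sq (norm_nonneg v)]
  exact ContinuousLinearMap.homothety_norm S happ
end

section
/- There exists a constant C > 0 such that for every real r ≥ 1, the cardinality of {z ∈ ℤ[1/p]^d : 𝕃(z) ≤ 2r} is at most C times the cardinality of {z ∈ ℤ[1/p]^d : 𝕃(z) ≤ r}; that is, 𝕃 has bounded doubling on ℤ[1/p]^d. -/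
open scoped BigOperators

/-- The additive subgroup `ℤ[1/p]^d` of `ℚ^d`, consisting of vectors `z` such that
`p^n z ∈ ℤ^d` for some `n ∈ ℕ`. -/
def solGroup (p d : ℕ) : AddSubgroup (Fin d → ℚ) where
  carrier := {z | ∃ n : ℕ, ∀ j, ∃ m : ℤ, (p : ℚ) ^ n * z j = m}
  zero_mem' := ⟨0, fun j => ⟨0, by simp⟩⟩
  add_mem' := by
    rintro x y ⟨a, hx⟩ ⟨b, hy⟩
    refine ⟨a + b, fun j => ?_⟩
    obtain ⟨m₁, h₁⟩ := hx j
    obtain ⟨m₂, h₂⟩ := hy j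
    refine ⟨(p : ℤ) ^ b * m₁ + (p : ℤ) ^ a * m₂, ?_⟩
    have : (p : ℚ) ^ (a + b) * (x + y) j
        = (p : ℚ) ^ b * ((p : ℚ) ^ a * x j) + (p : ℚ) ^ a * ((p : ℚ) ^ b * y j) := by
      simp [Pi.add_apply]; ring
    rw [this, h₁, h₂]
    push_cast
    ring
  neg_mem' := by
    rintro x ⟨a, hx⟩
    refine ⟨a, fun j => ?_⟩
    obtain ⟨m, h⟩ := hx j
    refine ⟨-m, ?_⟩
    have : (p : ℚ) ^ a * (-x) j = -((p : ℚ) ^ a * x j) := by simp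
    rw [this, h]
    push_cast
    ring

/-- The subgroup `G_n = (p^{-n} ℤ)^d`, as a predicate on `ℚ^d`. -/
def memGn (p d n : ℕ) (z : Fin d → ℚ) : Prop := ∀ j, ∃ m : ℤ, (p : ℚ) ^ n * z j = m

/-- `min {n ∈ ℕ : p^n z ∈ ℤ^d}`. -/
noncomputable def padMin (p d : ℕ) (z : Fin d → ℚ) : ℕ :=
  sInf {n : ℕ | ∀ j, ∃ m : ℤ, (p : ℚ) ^ n * z j = m}

/-- The function `𝔽(z) = p^{min {n ∈ ℕ : p^n z ∈ ℤ^d}}`. -/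
noncomputable def Fp (p d : ℕ) (z : Fin d → ℚ) : ℝ := (p : ℝ) ^ padMin p d z

/-- The length function `𝕃(z) = √(Σ_j z_j² + 𝔽(z)²)`. -/
noncomputable def Lp (p d : ℕ) (z : Fin d → ℚ) : ℝ :=
  Real.sqrt ((∑ j, ((z j : ℝ)) ^ 2) + (Fp p d z) ^ 2)

/-- The points of `(p^{-n} ℤ)^d` whose coordinates have absolute value at most `M / p^n`. -/
noncomputable def latticeBox (p d n M : ℕ) : Finset (Fin d → ℚ) :=
  (Fintype.piFinset fun _ : Fin d => Finset.Icc (-(M : ℤ)) M).image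
    fun m j => (m j : ℚ) / (p : ℚ) ^ n

theorem mem_latticeBox {p d n M : ℕ} (hp : p ≠ 0) {z : Fin d → ℚ} :
    z ∈ latticeBox p d n M ↔ ∀ j, ∃ m : ℤ, |m| ≤ M ∧ (p : ℚ) ^ n * z j = m := by
  have hpn : (p : ℚ) ^ n ≠ 0 := pow_ne_zero _ (by exact_mod_cast hp)
  simp only [latticeBox, Finset.mem_image, Fintype.mem_piFinset, Finset.mem_Icc]
  constructor
  · rintro ⟨m, hm, rfl⟩ j
    exact ⟨m j, abs_le.2 (hm j), by field_simp⟩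
  · intro h
    choose m hm hz using h
    refine ⟨m, fun j => abs_le.1 (hm j), ?_⟩
    ext j
    rw [← hz j]
    field_simp

theorem card_latticeBox {p d n M : ℕ} (hp : p ≠ 0) :
    (latticeBox p d n M).card = (2 * M + 1) ^ d := by
  have hpn : (p : ℚ) ^ n ≠ 0 := pow_ne_zero _ (by exact_mod_cast hp)
  rw [latticeBox, Finset.card_image_of_injective]
  · simp only [Fintype.card_piFinset, Int.card_Icc, Finset.prod_const, Finset.card_univ,
      Fintype.card_fin]
    congr 1
    omega
  · intro a b h
    ext j
    have := congrFun h j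
    simpa [div_left_inj' hpn] using this

theorem abs_le_Lp (p d : ℕ) (z : Fin d → ℚ) (j : Fin d) : |(z j : ℝ)| ≤ Lp p d z := by
  refine Real.abs_le_sqrt ?_
  have := Finset.single_le_sum (f := fun j => (z j : ℝ) ^ 2) (fun i _ => sq_nonneg _)
    (Finset.mem_univ j)
  nlinarith [sq_nonneg (Fp p d z)]

theorem Fp_le_Lp (p d : ℕ) (z : Fin d → ℚ) : Fp p d z ≤ Lp p d z := by
  refine Real.le_sqrt_of_sq_le ?_
  have : 0 ≤ ∑ j, (z j : ℝ) ^ 2 := Finset.sum_nonneg fun i _ => sq_nonneg _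
  linarith

theorem mem_latticeBox_of_Lp_le {p d n : ℕ} (hp : 2 ≤ p) {R : ℝ} (hR : R < (p : ℝ) ^ (n + 1))
    {z : Fin d → ℚ} (hz : z ∈ solGroup p d) (hL : Lp p d z ≤ R) :
    z ∈ latticeBox p d n ⌊R * (p : ℝ) ^ n⌋₊ := by
  rw [mem_latticeBox (by omega)]
  intro j
  have hmin : padMin p d z ∈ {n : ℕ | ∀ j, ∃ m : ℤ, (p : ℚ) ^ n * z j = m} := Nat.sInf_mem hz
  obtain ⟨m, hm⟩ := hmin j
  have hlt : (p : ℝ) ^ padMin p d z < (p : ℝ) ^ (n + 1) := ((Fp_le_Lp p d z).trans hL).trans_lt hR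
  have hle : padMin p d z ≤ n :=
    Nat.lt_succ_iff.1 ((pow_lt_pow_iff_right₀ (by exact_mod_cast hp)).1 hlt)
  have hint : (p : ℚ) ^ n * z j = ((p ^ (n - padMin p d z) * m : ℤ) : ℚ) := by
    push_cast
    rw [← hm, ← mul_assoc, ← pow_add, Nat.sub_add_cancel hle]
  refine ⟨_, ?_, hint⟩
  generalize (p ^ (n - padMin p d z) * m : ℤ) = k at hint
  have hk : (p : ℝ) ^ n * (z j : ℝ) = k := by exact_mod_cast congrArg (Rat.cast (K := ℝ)) hint
  rw [Int.abs_eq_natAbs, Int.ofNat_le]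
  refine Nat.le_floor ?_
  rw [Nat.cast_natAbs, Int.cast_abs, ← hk, abs_mul, abs_of_nonneg (by positivity), mul_comm]
  exact mul_le_mul_of_nonneg_right ((abs_le_Lp p d z j).trans hL) (by positivity)

theorem mem_ball_of_mem_latticeBox {p d n : ℕ} (hp : 2 ≤ p) (hd : 1 ≤ d) {r : ℝ}
    (hr : (p : ℝ) ^ n ≤ r / 2) {z : Fin d → ℚ}
    (hz : z ∈ latticeBox p d n ⌊(p : ℝ) ^ n * r / (2 * d)⌋₊) :
    z ∈ solGroup p d ∧ Lp p d z ≤ r := by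
  rw [mem_latticeBox (by omega)] at hz
  have hint : ∀ j, ∃ m : ℤ, (p : ℚ) ^ n * z j = m := fun j => (hz j).imp fun _ h => h.2
  refine ⟨⟨n, hint⟩, ?_⟩
  have hp1 : (1 : ℝ) ≤ p := by exact_mod_cast (by omega : 1 ≤ p)
  have hd1 : (1 : ℝ) ≤ d := by exact_mod_cast hd
  have hpn : (0 : ℝ) < (p : ℝ) ^ n := by positivity
  have hr0 : 0 < r := by linarith
  have hF : Fp p d z ≤ r / 2 := by
    have hmin : padMin p d z ≤ n := Nat.sInf_le hint
    exact (pow_le_pow_right₀ hp1 hmin).trans hr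
  have hF0 : 0 ≤ Fp p d z := by unfold Fp; positivity
  have hz' : ∀ j, (z j : ℝ) ^ 2 ≤ (r / (2 * d)) ^ 2 := by
    intro j
    obtain ⟨m, hm, hzm⟩ := hz j
    have hk : (p : ℝ) ^ n * (z j : ℝ) = m := by exact_mod_cast congrArg (Rat.cast (K := ℝ)) hzm
    rw [sq_le_sq, abs_of_nonneg (by positivity : 0 ≤ r / (2 * d))]
    refine le_of_mul_le_mul_left ?_ hpn
    calc (p : ℝ) ^ n * |(z j : ℝ)| = |(m : ℝ)| := by
          rw [← hk, abs_mul, abs_of_pos hpn]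
      _ ≤ (⌊(p : ℝ) ^ n * r / (2 * d)⌋₊ : ℝ) := by exact_mod_cast hm
      _ ≤ (p : ℝ) ^ n * r / (2 * d) := Nat.floor_le (by positivity)
      _ = _ := by ring
  have hsum : ∑ j, (z j : ℝ) ^ 2 ≤ r ^ 2 / 4 :=
    calc ∑ j, (z j : ℝ) ^ 2 ≤ ∑ _j : Fin d, (r / (2 * d)) ^ 2 := Finset.sum_le_sum fun j _ => hz' j
      _ = r ^ 2 / 4 / d := by
          simp only [Finset.sum_const, Finset.card_univ, Fintype.card_fin, nsmul_eq_mul]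
          field_simp
          norm_num
      _ ≤ r ^ 2 / 4 := div_le_self (by positivity) hd1
  refine Real.sqrt_le_iff.2 ⟨hr0.le, ?_⟩
  nlinarith

/-- There is a constant `C > 0` such that for every real `r ≥ 1` the
cardinality of `{z ∈ ℤ[1/p]^d : 𝕃(z) ≤ 2r}` is at most `C` times the cardinality of
`{z ∈ ℤ[1/p]^d : 𝕃(z) ≤ r}`; that is, `𝕃` has bounded doubling. -/
theorem Lp_bounded_doubling (p d : ℕ) (hp : 2 ≤ p) (hd : 2 ≤ d) :
    ∃ C : ℝ, 0 < C ∧ ∀ r : ℝ, 1 ≤ r →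
      ({z : Fin d → ℚ | z ∈ solGroup p d ∧ Lp p d z ≤ 2 * r}.ncard : ℝ) ≤
        C * ({z : Fin d → ℚ | z ∈ solGroup p d ∧ Lp p d z ≤ r}.ncard : ℝ) := by
  have hp0 : p ≠ 0 := by omega
  have hp2 : (2 : ℝ) ≤ p := by exact_mod_cast hp
  have hd1 : (1 : ℝ) ≤ d := by exact_mod_cast (by omega : 1 ≤ d)
  refine ⟨(10 * d * p ^ 2) ^ d, by positivity, fun r hr => ?_⟩
  obtain ⟨n, hn, hn'⟩ := exists_nat_pow_near hr (by linarith : (1 : ℝ) < p)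
  have hpn : (1 : ℝ) ≤ (p : ℝ) ^ (n + 1) := one_le_pow₀ (by linarith)
  have hR : 2 * r < (p : ℝ) ^ (n + 1 + 1) := by
    rw [pow_succ]
    nlinarith
  have hsub : {z : Fin d → ℚ | z ∈ solGroup p d ∧ Lp p d z ≤ 2 * r} ⊆
      latticeBox p d (n + 1) ⌊2 * r * (p : ℝ) ^ (n + 1)⌋₊ :=
    fun z hz => mem_latticeBox_of_Lp_le hp hR hz.1 hz.2
  have hfin : {z : Fin d → ℚ | z ∈ solGroup p d ∧ Lp p d z ≤ r}.Finite :=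
    (Finset.finite_toSet _).subset fun z hz => hsub ⟨hz.1, hz.2.trans (by linarith)⟩
  have hupper : ({z : Fin d → ℚ | z ∈ solGroup p d ∧ Lp p d z ≤ 2 * r}.ncard : ℝ) ≤
      (5 * r * (p : ℝ) ^ (n + 1)) ^ d := by
    have h := Set.ncard_le_ncard hsub (Finset.finite_toSet _)
    rw [Set.ncard_coe_finset, card_latticeBox hp0] at h
    have hfl := Nat.floor_le (by positivity : 0 ≤ 2 * r * (p : ℝ) ^ (n + 1))
    calc _ ≤ (2 * (⌊2 * r * (p : ℝ) ^ (n + 1)⌋₊ : ℝ) + 1) ^ d := by exact_mod_cast h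
      _ ≤ _ := by
        gcongr
        nlinarith
  refine hupper.trans ?_
  rcases n with _ | n
  · have hone : (1 : ℝ) ≤ {z : Fin d → ℚ | z ∈ solGroup p d ∧ Lp p d z ≤ r}.ncard := by
      have hpad : padMin p d 0 = 0 := Nat.sInf_eq_zero.2 (Or.inl fun j => ⟨0, by simp⟩)
      have : 0 < {z : Fin d → ℚ | z ∈ solGroup p d ∧ Lp p d z ≤ r}.ncard :=
        (Set.ncard_pos hfin).2 ⟨0, zero_mem _, by simpa [Lp, Fp, hpad] using hr⟩
      exact_mod_cast this
    refine le_trans ?_ (le_mul_of_one_le_right (by positivity) hone)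
    refine pow_le_pow_left₀ (by positivity) ?_ d
    simp only [zero_add, pow_one] at hn' ⊢
    nlinarith [mul_le_mul_of_nonneg_right hn'.le (by linarith : (0 : ℝ) ≤ p),
      mul_le_mul_of_nonneg_right hd1 (sq_nonneg (p : ℝ))]
  · have hr2 : (p : ℝ) ^ n ≤ r / 2 := by
      rw [pow_succ] at hn
      nlinarith [pow_pos (by linarith : (0 : ℝ) < p) n]
    have hlower : ((p : ℝ) ^ n * r / (2 * d)) ^ d ≤
        ({z : Fin d → ℚ | z ∈ solGroup p d ∧ Lp p d z ≤ r}.ncard : ℝ) := by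
      have h := Set.ncard_le_ncard (s := (latticeBox p d n ⌊(p : ℝ) ^ n * r / (2 * d)⌋₊ : Set _))
        (fun z hz => mem_ball_of_mem_latticeBox hp (by omega) hr2 hz) hfin
      rw [Set.ncard_coe_finset, card_latticeBox hp0] at h
      have hfl := Nat.lt_floor_add_one ((p : ℝ) ^ n * r / (2 * d))
      calc _ ≤ (2 * (⌊(p : ℝ) ^ n * r / (2 * d)⌋₊ : ℝ) + 1) ^ d := by
            gcongr
            linarith [Nat.cast_nonneg (α := ℝ) ⌊(p : ℝ) ^ n * r / (2 * d)⌋₊]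
        _ ≤ _ := by exact_mod_cast h
    refine le_trans (le_of_eq ?_) (mul_le_mul_of_nonneg_left hlower (by positivity))
    rw [← mul_pow]
    congr 1
    field_simp
    ring
end

section
/- There exists a real number s > 0 such that the family (𝕃(z)^{−s})_{z ∈ ℤ[1/p]^d} = ((Σ_{j=1}^d z_j² + 𝔽(z)²)^{−s/2})_{z ∈ ℤ[1/p]^d} is summable. (This expresses the finite summability of the spectral triple on the noncommutative solenoid, whose Dirac operator D satisfies |D| = multiplication by 𝕃.) -/
open scoped BigOperators

theorem padMin_spec {p d : ℕ} (z : solGroup p d) (j : Fin d) :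
    ∃ m : ℤ, (p : ℚ) ^ padMin p d z * (z : Fin d → ℚ) j = m :=
  Nat.sInf_mem (s := {n : ℕ | ∀ j, ∃ m : ℤ, (p : ℚ) ^ n * (z : Fin d → ℚ) j = m}) z.2 j

theorem Lp_nonneg (p d : ℕ) (z : Fin d → ℚ) : 0 ≤ Lp p d z := Real.sqrt_nonneg _

theorem one_le_Fp {p : ℕ} (hp : 1 ≤ p) (d : ℕ) (z : Fin d → ℚ) : 1 ≤ Fp p d z :=
  one_le_pow₀ (by exact_mod_cast hp)

/-- The vector `(𝔽(z), 𝔽(z) z)` of `ℝ^(d+1)`, which is integral when `z ∈ ℤ[1/p]^d`. -/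
noncomputable def clearDenom (p d : ℕ) (z : Fin d → ℚ) : Option (Fin d) → ℝ
  | none => Fp p d z
  | some j => Fp p d z * z j

theorem clearDenom_injective {p : ℕ} (hp : 1 ≤ p) (d : ℕ) :
    Function.Injective (clearDenom p d) := by
  intro x y h
  have h0 : Fp p d x = Fp p d y := congrFun h none
  have hpos : Fp p d y ≠ 0 := (zero_lt_one.trans_le (one_le_Fp hp d y)).ne'
  ext1 j
  have hj : Fp p d x * x j = Fp p d y * y j := congrFun h (some j)
  rw [h0] at hj
  exact_mod_cast mul_left_cancel₀ hpos hj

theorem clearDenom_mem_span {p d : ℕ} (z : solGroup p d) :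
    clearDenom p d z ∈
      Submodule.span ℤ (Set.range (Pi.basisFun ℝ (Option (Fin d)))) := by
  rw [Module.Basis.mem_span_iff_repr_mem]
  rintro (_ | j)
  · exact ⟨(p : ℤ) ^ padMin p d z, by simp [clearDenom, Fp]⟩
  · obtain ⟨m, hm⟩ := padMin_spec z j
    refine ⟨m, ?_⟩
    have : ((p : ℝ) ^ padMin p d z * ((z : Fin d → ℚ) j : ℝ)) = m := by exact_mod_cast hm
    simp [clearDenom, Fp, this]

theorem norm_clearDenom_le {p : ℕ} (hp : 1 ≤ p) (d : ℕ) (z : Fin d → ℚ) :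
    ‖clearDenom p d z‖ ≤ Lp p d z ^ 2 := by
  have h1 := one_le_Fp hp d z
  have hF := Fp_le_Lp p d z
  refine (pi_norm_le_iff_of_nonneg (by positivity)).2 ?_
  rintro (_ | j)
  · rw [clearDenom, Real.norm_of_nonneg (by linarith)]
    nlinarith
  · rw [clearDenom, norm_mul, Real.norm_of_nonneg (by linarith), sq]
    exact mul_le_mul hF (abs_le_Lp p d z j) (norm_nonneg _) (Lp_nonneg p d z)

theorem norm_clearDenom_pos {p : ℕ} (hp : 1 ≤ p) (d : ℕ) (z : Fin d → ℚ) :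
    0 < ‖clearDenom p d z‖ := by
  refine norm_pos_iff.2 fun h => ?_
  have h0 : Fp p d z = 0 := congrFun h none
  linarith [one_le_Fp hp d z]

/-- There exists a real `s > 0` such that the family
`(𝕃(z)^{−s})_{z ∈ ℤ[1/p]^d} = ((Σ_j z_j² + 𝔽(z)²)^{−s/2})_{z ∈ ℤ[1/p]^d}` is summable.
(Finite summability of the spectral triple on the noncommutative solenoid, whose Dirac
operator `D` satisfies `|D| =` multiplication by `𝕃`.) -/
theorem Lp_finitely_summable (p d : ℕ) (hp : 2 ≤ p) (hd : 2 ≤ d) :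
    ∃ s : ℝ, 0 < s ∧
      Summable (fun z : solGroup p d => Lp p d (z : Fin d → ℚ) ^ (-s)) := by
  have hp1 : 1 ≤ p := by omega
  set Λ := Submodule.span ℤ (Set.range (Pi.basisFun ℝ (Option (Fin d))))
  set r : ℝ := Module.finrank ℤ Λ + 1 with hr
  have hr0 : 0 < r := by positivity
  refine ⟨2 * r, by positivity, ?_⟩
  let φ : solGroup p d → Λ := fun z => ⟨clearDenom p d z, clearDenom_mem_span z⟩
  have hφ : Function.Injective φ := fun x y h =>
    Subtype.ext (clearDenom_injective hp1 d (congrArg Subtype.val h))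
  have hsum := (ZLattice.summable_norm_rpow Λ (-r) (by rw [hr]; linarith)).comp_injective hφ
  refine hsum.of_nonneg_of_le (fun z => Real.rpow_nonneg (Lp_nonneg p d z) _) fun z => ?_
  calc Lp p d z ^ (-(2 * r)) = (Lp p d z ^ 2) ^ (-r) := by
        rw [← Real.rpow_natCast, ← Real.rpow_mul (Lp_nonneg p d z)]
        congr 1
        push_cast
        ring
    _ ≤ ‖clearDenom p d z‖ ^ (-r) :=
        Real.rpow_le_rpow_of_nonpos (norm_clearDenom_pos hp1 d z)
          (norm_clearDenom_le hp1 d z) (by linarith)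
end

section
/- The abelian group Ext¹_ℤ(ℤ[1/p], ℤ) (the first Ext group of ℤ-modules) is isomorphic to the quotient I_p/ℤ of the additive group of the ring I_p of p-adic integers by the image of the canonical embedding ℤ → I_p. -/
/-- The additive subgroup `ℤ[1/p] = {m/p^n : m ∈ ℤ, n ∈ ℕ}` of `ℚ`. -/
def padicRat (p : ℕ) : AddSubgroup ℚ where
  carrier := {q | ∃ (n : ℕ) (m : ℤ), (p : ℚ) ^ n * q = m}
  zero_mem' := ⟨0, 0, by simp⟩
  add_mem' := by
    rintro x y ⟨a, m₁, h₁⟩ ⟨b, m₂, h₂⟩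
    refine ⟨a + b, (p : ℤ) ^ b * m₁ + (p : ℤ) ^ a * m₂, ?_⟩
    have : (p : ℚ) ^ (a + b) * (x + y)
        = (p : ℚ) ^ b * ((p : ℚ) ^ a * x) + (p : ℚ) ^ a * ((p : ℚ) ^ b * y) := by ring
    rw [this, h₁, h₂]
    push_cast
    ring
  neg_mem' := by
    rintro x ⟨a, m, h⟩
    exact ⟨a, -m, by rw [mul_neg, h]; push_cast; ring⟩

open CategoryTheory

namespace CategoryTheory.ShortComplex
open Limits ZeroObject

variable {C : Type*} [Category* C] [Abelian C]

/-- The objects of the two-term complex attached to the first map of a short complex. -/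
noncomputable def twoTermX (S : ShortComplex C) : ℕ → C
  | 0 => S.X₂
  | 1 => S.X₁
  | _ + 2 => 0

/-- The differentials of the two-term complex attached to the first map of a short complex. -/
noncomputable def twoTermD (S : ShortComplex C) : ∀ n, S.twoTermX (n + 1) ⟶ S.twoTermX n
  | 0 => S.f
  | _ + 1 => 0

/-- The chain complex `⋯ ⟶ 0 ⟶ S.X₁ ⟶ S.X₂`, with `S.X₂` in degree `0`. -/
noncomputable def twoTermComplex (S : ShortComplex C) : ChainComplex C ℕ :=
  ChainComplex.of S.twoTermX S.twoTermD fun _ => zero_comp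

lemma isZero_twoTermComplex_X (S : ShortComplex C) (n : ℕ) :
    IsZero (S.twoTermComplex.X (n + 2)) :=
  isZero_zero C

lemma twoTermComplex_d_one_zero (S : ShortComplex C) : S.twoTermComplex.d 1 0 = S.f :=
  ChainComplex.of_d S.twoTermX S.twoTermD 0

/-- The augmentation of the two-term complex of `S` given by `S.g : S.X₂ ⟶ S.X₃`. -/
noncomputable def twoTermAugmentation (S : ShortComplex C) :
    S.twoTermComplex ⟶ (ChainComplex.single₀ C).obj S.X₃ :=
  (ChainComplex.toSingle₀Equiv _ _).symm ⟨S.g, by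
    rw [twoTermComplex_d_one_zero]
    exact S.zero⟩

lemma twoTermAugmentation_f_zero (S : ShortComplex C) : S.twoTermAugmentation.f 0 = S.g :=
  ChainComplex.toSingle₀Equiv_symm_apply_f_zero _ _

namespace ShortExact

variable {S : ShortComplex C}

lemma twoTermComplex_exactAt_succ (hS : S.ShortExact) (n : ℕ) :
    S.twoTermComplex.ExactAt (n + 1) := by
  rw [HomologicalComplex.exactAt_iff' _ (n + 1 + 1) (n + 1) n (by simp) (by simp)]
  cases n with
  | zero =>
    have := hS.mono_f
    refine (ShortComplex.exact_iff_mono _ ((S.isZero_twoTermComplex_X 0).eq_of_src _ _)).2 ?_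
    change Mono (S.twoTermComplex.d 1 0)
    rwa [twoTermComplex_d_one_zero]
  | succ n => exact ShortComplex.exact_of_isZero_X₂ _ (S.isZero_twoTermComplex_X n)

/-- A short exact sequence `0 ⟶ X₁ ⟶ X₂ ⟶ X₃ ⟶ 0` with `X₁` and `X₂` projective is a projective
resolution of `X₃`. -/
noncomputable def projectiveResolution (hS : S.ShortExact) [h₁ : Projective S.X₁]
    [h₂ : Projective S.X₂] : ProjectiveResolution S.X₃ where
  complex := S.twoTermComplex
  projective n := match n with
    | 0 => h₂
    | 1 => h₁
    | n + 2 => (S.isZero_twoTermComplex_X n).projective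
  π := S.twoTermAugmentation
  quasiIso := ⟨fun n => by
    cases n
    · rw [ChainComplex.quasiIsoAt₀_iff, ShortComplex.quasiIso_iff_of_zeros']
      · refine (ShortComplex.exact_and_epi_g_iff_of_iso ?_).2 ⟨hS.exact, hS.epi_g⟩
        exact ShortComplex.isoMk (Iso.refl _) (Iso.refl _) (Iso.refl _)
          ((Category.id_comp _).trans
            (S.twoTermComplex_d_one_zero.symm.trans (Category.comp_id _).symm))
          ((Category.id_comp _).trans
            (S.twoTermAugmentation_f_zero.symm.trans (Category.comp_id _).symm))
      all_goals rfl
    · rw [quasiIsoAt_iff_exactAt']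
      · exact hS.twoTermComplex_exactAt_succ _
      · apply ChainComplex.exactAt_succ_single_obj⟩

universe u v

variable {R : Type u} [Ring R] {D : Type*} [Category.{v} D] [Abelian D] [Linear R D]
  [EnoughProjectives D] {S : ShortComplex D}

/-- For `0 ⟶ X₁ ⟶ X₂ ⟶ X₃ ⟶ 0` short exact with `X₁` and `X₂` projective, `Ext¹(X₃, Y)` is the
cokernel of `Hom(X₂, Y) ⟶ Hom(X₁, Y)`. -/
noncomputable def extOneIso (hS : S.ShortExact) [Projective S.X₁] [Projective S.X₂] (Y : D) :
    ((_root_.Ext R D 1).obj (Opposite.op S.X₃)).obj Y ≅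
      ModuleCat.of R ((S.X₁ ⟶ Y) ⧸ LinearMap.range (Linear.leftComp R Y S.f)) :=
  hS.projectiveResolution.isoExt 1 Y ≪≫
  ShortComplex.homologyMapIso (HomologicalComplex.isoSc' _ 0 1 2 (by simp) (by simp)) ≪≫
  (ShortComplex.LeftHomologyData.ofIsColimitCokernelCofork _ (by
    ext (x : S.X₁ ⟶ Y)
    exact (S.isZero_twoTermComplex_X 0).eq_of_src _ _) _
    (ModuleCat.cokernelIsColimit _)).homologyIso ≪≫
  (Submodule.quotEquivOfEq _ _ (by
    congr 1
    ext x
    exact congr_arg (· ≫ x) S.twoTermComplex_d_one_zero)).toModuleIso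

end ShortExact

end CategoryTheory.ShortComplex

section Presentation

/-- The endomorphism `eₙ ↦ eₙ - p eₙ₊₁` of the free abelian group on `ℕ`. -/
noncomputable def padicRatRel (p : ℕ) : (ℕ →₀ ℤ) →ₗ[ℤ] (ℕ →₀ ℤ) :=
  LinearMap.id - (p : ℤ) • Finsupp.lmapDomain ℤ ℤ Nat.succ

lemma padicRatRel_single (p n : ℕ) (a : ℤ) :
    padicRatRel p (Finsupp.single n a) = Finsupp.single n a - Finsupp.single (n + 1) (p * a) := by
  simp [padicRatRel, Finsupp.mapDomain_single]

lemma padicRatRel_injective (p : ℕ) : Function.Injective (padicRatRel p) := by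
  rw [injective_iff_map_eq_zero]
  intro x hx
  ext n
  induction n with
  | zero =>
    have := DFunLike.congr_fun hx 0
    simpa [padicRatRel, Finsupp.mapDomain_of_notMem_range] using this
  | succ n ih =>
    have := DFunLike.congr_fun hx (n + 1)
    simp only [padicRatRel, LinearMap.sub_apply, LinearMap.smul_apply, LinearMap.id_apply,
      Finsupp.lmapDomain_apply, Finsupp.sub_apply, Finsupp.smul_apply, ← Nat.succ_eq_add_one,
      Finsupp.mapDomain_apply Nat.succ_injective, ih] at this
    simpa using this

variable {p : ℕ}

lemma inv_pow_mem_padicRat (hp : p ≠ 0) (n : ℕ) : ((p : ℚ) ^ n)⁻¹ ∈ padicRat p :=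
  ⟨n, 1, by simp [hp]⟩

/-- The surjection `eₙ ↦ 1 / p ^ n` from the free abelian group on `ℕ` onto `ℤ[1/p]`. -/
noncomputable def padicRatGen (hp : p ≠ 0) : (ℕ →₀ ℤ) →ₗ[ℤ] padicRat p :=
  Finsupp.linearCombination ℤ fun n => ⟨((p : ℚ) ^ n)⁻¹, inv_pow_mem_padicRat hp n⟩

lemma coe_padicRatGen_single (hp : p ≠ 0) (n : ℕ) (a : ℤ) :
    (padicRatGen hp (Finsupp.single n a) : ℚ) = a * ((p : ℚ) ^ n)⁻¹ := by
  simp [padicRatGen]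

lemma padicRatGen_surjective (hp : p ≠ 0) : Function.Surjective (padicRatGen hp) := by
  rintro ⟨q, n, m, h⟩
  refine ⟨Finsupp.single n m, Subtype.ext ?_⟩
  rw [coe_padicRatGen_single, ← h]
  field_simp

lemma padicRatGen_padicRatRel (hp : p ≠ 0) (x : ℕ →₀ ℤ) :
    padicRatGen hp (padicRatRel p x) = 0 := by
  induction x using Finsupp.induction_linear with
  | zero => simp
  | add x y hx hy => simp [hx, hy]
  | single n a =>
    rw [padicRatRel_single, map_sub, sub_eq_zero]
    ext
    rw [coe_padicRatGen_single, coe_padicRatGen_single, pow_succ]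
    push_cast
    field_simp

lemma single_sub_single_mem_range_padicRatRel (p n k : ℕ) (a : ℤ) :
    Finsupp.single n a - Finsupp.single (n + k) (p ^ k * a) ∈ LinearMap.range (padicRatRel p) := by
  induction k with
  | zero => simp
  | succ k ih =>
    have := add_mem ih (LinearMap.mem_range_self (padicRatRel p)
      (Finsupp.single (n + k) ((p : ℤ) ^ k * a)))
    rw [padicRatRel_single, sub_add_sub_cancel] at this
    rwa [← mul_assoc, ← pow_succ'] at this

lemma exists_sub_single_mem_range_padicRatRel (p : ℕ) (x : ℕ →₀ ℤ) :
    ∃ (n : ℕ) (a : ℤ), x - Finsupp.single n a ∈ LinearMap.range (padicRatRel p) := by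
  induction x using Finsupp.induction_linear with
  | zero => exact ⟨0, 0, by simp⟩
  | single n a => exact ⟨n, a, by simp⟩
  | add x y hx hy =>
    obtain ⟨n, a, hx⟩ := hx
    obtain ⟨m, b, hy⟩ := hy
    refine ⟨n + m, p ^ m * a + p ^ n * b, ?_⟩
    have h₁ := add_mem hx (single_sub_single_mem_range_padicRatRel p n m a)
    have h₂ := add_mem hy (single_sub_single_mem_range_padicRatRel p m n b)
    convert add_mem h₁ h₂ using 1
    rw [Finsupp.single_add, add_comm m n]
    abel

lemma padicRatRel_exact (hp : p ≠ 0) : Function.Exact (padicRatRel p) (padicRatGen hp) := by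
  intro x
  refine ⟨fun hx => ?_, ?_⟩
  · obtain ⟨n, a, y, hy⟩ := exists_sub_single_mem_range_padicRatRel p x
    have h := congr_arg (padicRatGen hp) hy
    rw [padicRatGen_padicRatRel, map_sub, hx, zero_sub, zero_eq_neg, Subtype.ext_iff,
      coe_padicRatGen_single] at h
    have ha : a = 0 := by simpa [hp] using h
    exact ⟨y, by simpa [ha] using hy⟩
  · rintro ⟨y, rfl⟩
    exact padicRatGen_padicRatRel hp y

/-- The presentation `0 ⟶ ℤ^(ℕ) ⟶ ℤ^(ℕ) ⟶ ℤ[1/p] ⟶ 0`. -/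
noncomputable abbrev padicRatShortComplex (hp : p ≠ 0) : ShortComplex (ModuleCat.{0} ℤ) :=
  .mk (ModuleCat.ofHom (padicRatRel p)) (ModuleCat.ofHom (padicRatGen hp)) <| by
    exact ModuleCat.hom_ext (LinearMap.ext (padicRatGen_padicRatRel hp))

lemma padicRatShortComplex_shortExact (hp : p ≠ 0) : (padicRatShortComplex hp).ShortExact where
  exact := (ShortComplex.ShortExact.moduleCat_exact_iff_function_exact _).2
    (padicRatRel_exact hp)
  mono_f := (ModuleCat.mono_iff_injective _).2 (padicRatRel_injective p)
  epi_g := (ModuleCat.epi_iff_surjective _).2 (padicRatGen_surjective hp)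

end Presentation

section Series

variable {p : ℕ} [Fact p.Prime]

open PadicInt

lemma PadicInt.summable_intCast_mul_pow (a : ℕ → ℤ) :
    Summable fun n => (a n : ℤ_[p]) * (p : ℤ_[p]) ^ n := by
  refine Summable.of_norm_bounded (g := fun n => ((p : ℝ)⁻¹) ^ n) ?_ fun n => ?_
  · refine summable_geometric_of_lt_one (by positivity) (inv_lt_one_of_one_lt₀ ?_)
    exact_mod_cast (Fact.out : p.Prime).one_lt
  · rw [norm_mul, norm_pow, PadicInt.norm_p]
    exact mul_le_of_le_one_left (by positivity) (PadicInt.norm_le_one _)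

/-- The `p`-adic integer `∑ aₙ pⁿ` with given integral coefficients. -/
noncomputable def PadicInt.ofCoeffs (p : ℕ) [Fact p.Prime] : (ℕ → ℤ) →+ ℤ_[p] where
  toFun a := ∑' n, (a n : ℤ_[p]) * (p : ℤ_[p]) ^ n
  map_zero' := by simp
  map_add' a b := by
    rw [← (summable_intCast_mul_pow a).tsum_add (summable_intCast_mul_pow b)]
    simp [add_mul]

lemma PadicInt.pow_dvd_ofCoeffs_sub_sum (a : ℕ → ℤ) (n : ℕ) :
    (p : ℤ_[p]) ^ n ∣ ofCoeffs p a - ((∑ k ∈ Finset.range n, a k * p ^ k : ℤ) : ℤ_[p]) := by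
  have h := (summable_intCast_mul_pow (p := p) a).sum_add_tsum_nat_add n
  refine ⟨∑' k, (a (k + n) : ℤ_[p]) * (p : ℤ_[p]) ^ k, ?_⟩
  rw [← (summable_intCast_mul_pow fun k => a (k + n)).tsum_mul_left, sub_eq_iff_eq_add']
  push_cast
  refine h.symm.trans ?_
  congr 2
  ext k
  ring

lemma PadicInt.eq_of_pow_dvd_sub {x y : ℤ_[p]} (h : ∀ n : ℕ, (p : ℤ_[p]) ^ n ∣ x - y) : x = y := by
  refine ext_of_toZModPow.1 fun n => ?_
  rw [← sub_eq_zero, ← map_sub, ← RingHom.mem_ker, ker_toZModPow, Ideal.mem_span_singleton]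
  exact h n

lemma PadicInt.eq_ofCoeffs {a : ℕ → ℤ} {x : ℤ_[p]}
    (h : ∀ n, (p : ℤ_[p]) ^ n ∣ x - ((∑ k ∈ Finset.range n, a k * p ^ k : ℤ) : ℤ_[p])) :
    x = ofCoeffs p a := by
  refine eq_of_pow_dvd_sub fun n => ?_
  simpa using dvd_sub (h n) (pow_dvd_ofCoeffs_sub_sum a n)

lemma PadicInt.ofCoeffs_surjective : Function.Surjective (ofCoeffs p) := by
  intro x
  have h (n : ℕ) : ∃ c : ℤ, (x.appr (n + 1) : ℤ) - x.appr n = p ^ n * c := by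
    obtain ⟨c, hc⟩ := dvd_appr_sub_appr x n (n + 1) n.le_succ
    refine ⟨c, ?_⟩
    rw [← Nat.cast_sub (appr_mono x n.le_succ), hc]
    push_cast
    rfl
  choose a ha using h
  refine ⟨a, (eq_ofCoeffs fun n => ?_).symm⟩
  have hs : ∑ k ∈ Finset.range n, a k * (p : ℤ) ^ k = x.appr n := by
    simp_rw [mul_comm (a _), ← ha]
    rw [Finset.sum_range_sub (fun n => (x.appr n : ℤ))]
    simp [appr]
  rw [hs]
  simpa using Ideal.mem_span_singleton.1 (appr_spec n x)

lemma PadicInt.ofCoeffs_mem_range_intCast_iff (a : ℕ → ℤ) :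
    ofCoeffs p a ∈ (Int.castAddHom ℤ_[p]).range ↔ ∃ b : ℕ → ℤ, ∀ n, a n = b n - p * b (n + 1) := by
  have hp : (p : ℤ) ≠ 0 := by exact_mod_cast (Fact.out : p.Prime).ne_zero
  constructor
  · rintro ⟨c, hc⟩
    have h (n : ℕ) : ∃ b : ℤ, c - ∑ k ∈ Finset.range n, a k * p ^ k = p ^ n * b := by
      have := pow_dvd_ofCoeffs_sub_sum (p := p) a n
      rw [← hc, Int.coe_castAddHom, ← Int.cast_sub] at this
      exact_mod_cast (pow_p_dvd_int_iff _ _).1 this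
    choose b hb using h
    refine ⟨b, fun n => mul_left_cancel₀ (pow_ne_zero n hp) ?_⟩
    have := hb (n + 1)
    rw [Finset.sum_range_succ] at this
    linear_combination hb n - this
  · rintro ⟨b, hb⟩
    refine ⟨b 0, eq_ofCoeffs fun n => ?_⟩
    have hs : ∑ k ∈ Finset.range n, a k * (p : ℤ) ^ k = b 0 - p ^ n * b n := by
      induction n with
      | zero => simp
      | succ n ih => rw [Finset.sum_range_succ, ih, hb]; ring
    rw [hs]
    simp

end Series

section Quotient

variable (p : ℕ) [Fact p.Prime]

/-- The class modulo `ℤ` of `∑ f(eₙ) pⁿ`, for a homomorphism `f` from the free abelian group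
on `ℕ` to `ℤ`. -/
noncomputable def homToPadicIntQuotient :
    (ModuleCat.of ℤ (ℕ →₀ ℤ) ⟶ ModuleCat.of ℤ ℤ) →ₗ[ℤ]
      ℤ_[p] ⧸ (Int.castAddHom ℤ_[p]).range where
  toFun f := QuotientAddGroup.mk (PadicInt.ofCoeffs p fun n => f (Finsupp.single n 1))
  map_add' f g := by
    rw [← QuotientAddGroup.mk_add, ← map_add]
    rfl
  map_smul' c f := by
    rw [RingHom.id_apply, ← QuotientAddGroup.mk_zsmul, ← map_zsmul]
    rfl

lemma homToPadicIntQuotient_surjective : Function.Surjective (homToPadicIntQuotient p) := by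
  intro x
  obtain ⟨x, rfl⟩ := QuotientAddGroup.mk_surjective x
  obtain ⟨a, rfl⟩ := PadicInt.ofCoeffs_surjective x
  refine ⟨ModuleCat.ofHom (Finsupp.linearCombination ℤ a), ?_⟩
  simp [homToPadicIntQuotient]

lemma ker_homToPadicIntQuotient :
    LinearMap.ker (homToPadicIntQuotient p) =
      LinearMap.range (Linear.leftComp ℤ (ModuleCat.of ℤ ℤ) (ModuleCat.ofHom (padicRatRel p))) := by
  ext f
  have h : homToPadicIntQuotient p f = 0 ↔ _ := (QuotientAddGroup.eq_zero_iff _).trans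
    (PadicInt.ofCoeffs_mem_range_intCast_iff _)
  rw [LinearMap.mem_ker, h, LinearMap.mem_range]
  have key (g : (ℕ →₀ ℤ) →ₗ[ℤ] ℤ) (n : ℕ) : g (padicRatRel p (Finsupp.single n 1)) =
      g (Finsupp.single n 1) - p * g (Finsupp.single (n + 1) 1) := by
    rw [padicRatRel_single, map_sub, ← smul_eq_mul (p : ℤ) (1 : ℤ), ← Finsupp.smul_single, map_smul,
      smul_eq_mul]
  constructor
  · rintro ⟨b, hb⟩
    refine ⟨ModuleCat.ofHom (Finsupp.linearCombination ℤ b), ?_⟩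
    refine ModuleCat.hom_ext (Finsupp.lhom_ext' fun n => LinearMap.ext_ring ?_)
    refine (key (Finsupp.linearCombination ℤ b) n).trans (Eq.trans ?_ (hb n).symm)
    simp
  · rintro ⟨g, rfl⟩
    exact ⟨fun n => g (Finsupp.single n 1), fun n => key g.hom n⟩

end Quotient

/-- The abelian group `Ext¹_ℤ(ℤ[1/p], ℤ)` (the first Ext group of
ℤ-modules) is isomorphic to the quotient `I_p/ℤ` of the additive group of the ring `I_p`
of `p`-adic integers by the image of the canonical embedding `ℤ → I_p`. -/
theorem ext_padicRat_int_equiv_padicInt_quotient (p : ℕ) [Fact p.Prime] :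
    Nonempty (
      (((_root_.Ext ℤ (ModuleCat.{0} ℤ) 1).obj
          (Opposite.op (ModuleCat.of ℤ (padicRat p)))).obj (ModuleCat.of ℤ ℤ))
        ≃+ (PadicInt p ⧸ (Int.castAddHom (PadicInt p)).range)) := by
  have hp : p ≠ 0 := (Fact.out : p.Prime).ne_zero
  have : Projective (ModuleCat.of ℤ (ℕ →₀ ℤ)) :=
    ModuleCat.projective_of_free Finsupp.basisSingleOne
  have : Projective (padicRatShortComplex hp).X₁ := this
  have : Projective (padicRatShortComplex hp).X₂ := this
  exact ⟨((padicRatShortComplex_shortExact hp).extOneIso (R := ℤ)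
      (ModuleCat.of ℤ ℤ)).toLinearEquiv.toAddEquiv.trans
    ((Submodule.quotEquivOfEq _ _ (ker_homToPadicIntQuotient p).symm).trans
      ((homToPadicIntQuotient p).quotKerEquivOfSurjective
        (homToPadicIntQuotient_surjective p))).toAddEquiv⟩
end
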